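/- Let 1<p<∞ and 0<sp<n. Assume that E ⊂ ℝⁿ is closed and (s,p)-uniformly fat. Then there exist λ with n−sp<λ≤n and a constant C>0 such that H^λ_∞(B(x,r)∩E) ≥ C r^λ for every x ∈ E and every r>0. -/

import Mathlib

open MeasureTheory Metric Set
open scoped ENNReal NNReal Topology

noncomputable section

/-- Euclidean space `ℝⁿ`. -/
abbrev Euc (n : ℕ) := EuclideanSpace ℝ (Fin n)

/-- The `λ`-Hausdorff content of a set `E ⊆ ℝⁿ`:
`H^λ_∞(E) = inf { Σ_i r_i^λ : E ⊆ ⋃_i B(x_i, r_i), r_i > 0 }`. -/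
def hContent (n : ℕ) (lam : ℝ) (E : Set (Euc n)) : ℝ≥0∞ :=
  ⨅ (c : ℕ → Euc n × ℝ) (_ : ∀ i, 0 < (c i).2)
    (_ : E ⊆ ⋃ i, Metric.ball (c i).1 (c i).2),
    ∑' i, ENNReal.ofReal ((c i).2 ^ lam)

/-- The Riesz `(s,p)`-capacity of a set `E ⊆ ℝⁿ`:
`R_{s,p}(E) = inf { ‖f‖_p^p : f ≥ 0, I_s f ≥ 1 on E }`, where
`I_s f (x) = ∫ f(y) |x-y|^{s-n} dy`. -/
def rieszCap (n : ℕ) (s p : ℝ) (E : Set (Euc n)) : ℝ≥0∞ :=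
  ⨅ (f : Euc n → ℝ) (_ : Measurable f) (_ : ∀ x, 0 ≤ f x)
    (_ : ∀ x ∈ E, 1 ≤ ∫⁻ y, ENNReal.ofReal (f y) * ENNReal.ofReal (dist x y ^ (s - (n : ℝ)))),
    ∫⁻ x, ENNReal.ofReal (f x ^ p)

/-- A set `E ⊆ ℝⁿ` is `(s,p)`-uniformly fat:
`R_{s,p}(B(x,r) ∩ E) ≥ σ r^{n-sp}` for all `x ∈ E`, `r > 0`. -/
def UniformlyFat (n : ℕ) (s p : ℝ) (E : Set (Euc n)) : Prop :=
  ∃ σ : ℝ, 0 < σ ∧ ∀ x ∈ E, ∀ r : ℝ, 0 < r →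
    ENNReal.ofReal (σ * r ^ ((n : ℝ) - s * p)) ≤ rieszCap n s p (Metric.ball x r ∩ E)

/-- A set `E ⊆ ℝⁿ` is locally `(s,p)`-uniformly fat:
`R_{s,p}(B(x,r) ∩ E) ≥ σ r^{n-sp}` for all `x ∈ E`, `0 < r < r₀`. -/
def LocallyUniformlyFat (n : ℕ) (s p : ℝ) (E : Set (Euc n)) : Prop :=
  ∃ σ r₀ : ℝ, 0 < σ ∧ 0 < r₀ ∧ ∀ x ∈ E, ∀ r : ℝ, 0 < r → r < r₀ →
    ENNReal.ofReal (σ * r ^ ((n : ℝ) - s * p)) ≤ rieszCap n s p (Metric.ball x r ∩ E)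

/-- An open set `G ⊆ ℝⁿ` admits the `(s,p)`-Hardy inequality:
`∫_G |u|^p dist(x,∂G)^{-sp} dx ≤ c ∫_G ∫_G |u(x)-u(y)|^p |x-y|^{-(n+sp)} dy dx`
for every `u ∈ C_c^∞(G)`. -/
def AdmitsHardy (n : ℕ) (s p : ℝ) (G : Set (Euc n)) : Prop :=
  ∃ c : ℝ, 0 < c ∧ ∀ u : Euc n → ℝ,
    ContDiff ℝ (⊤ : ℕ∞) u → HasCompactSupport u → tsupport u ⊆ G →
    (∫⁻ x in G, ENNReal.ofReal (|u x| ^ p / Metric.infDist x (frontier G) ^ (s * p))) ≤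
      ENNReal.ofReal c *
        ∫⁻ x in G, ∫⁻ y in G, ENNReal.ofReal (|u x - u y| ^ p / dist x y ^ ((n : ℝ) + s * p))

/-- `U` is a `c`-John domain with center point `x₀`: every `x ∈ U` is joined to `x₀`
by an arc-length-parameterized (here: 1-Lipschitz) curve `γ : [0,ℓ] → U` with
`dist(γ(t), ∂U) ≥ t/c`. -/
def IsJohnDomain (n : ℕ) (c : ℝ) (U : Set (Euc n)) (x₀ : Euc n) : Prop :=
  IsOpen U ∧ IsConnected U ∧ x₀ ∈ U ∧
  ∀ x ∈ U, ∃ ℓ : ℝ, 0 ≤ ℓ ∧ ∃ γ : ℝ → Euc n,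
    LipschitzOnWith 1 γ (Set.Icc 0 ℓ) ∧ γ 0 = x ∧ γ ℓ = x₀ ∧
    ∀ t ∈ Set.Icc 0 ℓ, γ t ∈ U ∧ t / c ≤ Metric.infDist (γ t) (frontier U)

/-- `G_{x,c}`: the union of all `c`-John subdomains of `G` with center point `x`. -/
def johnPart (n : ℕ) (c : ℝ) (G : Set (Euc n)) (x : Euc n) : Set (Euc n) :=
  ⋃₀ {U : Set (Euc n) | U ⊆ G ∧ IsJohnDomain n c U x}

/-- The `c`-visual boundary of `G` near `x`: `∂^vis_{x,c} G = ∂G ∩ ∂G_{x,c}`. -/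
def visualBoundary (n : ℕ) (c : ℝ) (G : Set (Euc n)) (x : Euc n) : Set (Euc n) :=
  frontier G ∩ frontier (johnPart n c G x)

/-- `G` is a uniform domain with constant `C`. -/
def IsUniformDomain (n : ℕ) (C : ℝ) (G : Set (Euc n)) : Prop :=
  IsOpen G ∧ IsConnected G ∧
  ∀ x ∈ G, ∀ y ∈ G, ∃ ℓ : ℝ, 0 ≤ ℓ ∧ ℓ ≤ C * dist x y ∧
    ∃ γ : ℝ → Euc n, LipschitzOnWith 1 γ (Set.Icc 0 ℓ) ∧ γ 0 = x ∧ γ ℓ = y ∧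
      ∀ t ∈ Set.Icc 0 ℓ, γ t ∈ G ∧
        min (dist (γ t) x) (dist (γ t) y) / C ≤ Metric.infDist (γ t) (frontier G)

/-- The closed axis-parallel cube with center `z` and side length `ℓ`. -/
def cube (n : ℕ) (z : Euc n) (ℓ : ℝ) : Set (Euc n) := {y | ∀ i, |y i - z i| ≤ ℓ / 2}

/-- Distance between two sets. -/
def setSetDist (n : ℕ) (A B : Set (Euc n)) : ℝ := sInf (Set.image2 dist A B)

/-- `Q = cube z ℓ` is a Whitney cube of the open set `G`:
`Q ⊆ G` and `diam Q ≤ dist(Q, ∂G) ≤ 4 diam Q`. -/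
def IsWhitneyCube (n : ℕ) (G : Set (Euc n)) (z : Euc n) (ℓ : ℝ) : Prop :=
  0 < ℓ ∧ cube n z ℓ ⊆ G ∧
    Metric.diam (cube n z ℓ) ≤ setSetDist n (cube n z ℓ) (frontier G) ∧
    setSetDist n (cube n z ℓ) (frontier G) ≤ 4 * Metric.diam (cube n z ℓ)

/-- The `p`-th power of the Gagliardo `(s,p)`-seminorm of `u` on `A`:
`|u|_{W^{s,p}(A)}^p = ∫_A ∫_A |u(x)-u(y)|^p |x-y|^{-(n+sp)} dy dx`. -/
def gagliardoP (n : ℕ) (s p : ℝ) (A : Set (Euc n)) (u : Euc n → ℝ) : ℝ≥0∞ :=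
  ∫⁻ x in A, ∫⁻ y in A, ENNReal.ofReal (|u x - u y| ^ p / dist x y ^ ((n : ℝ) + s * p))

/-- `E` is an Ahlfors `λ`-regular set: `E` is closed and
`C⁻¹ r^λ ≤ H^λ(B(x,r) ∩ E) ≤ C r^λ` for `x ∈ E`, `0 < r < diam E`. -/
def AhlforsRegular (n : ℕ) (lam : ℝ) (E : Set (Euc n)) : Prop :=
  IsClosed E ∧ ∃ C : ℝ, 1 < C ∧ ∀ x ∈ E, ∀ r : ℝ, 0 < r →
    ENNReal.ofReal r < EMetric.diam E →
      ENNReal.ofReal (C⁻¹ * r ^ lam) ≤ μH[lam] (Metric.ball x r ∩ E) ∧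
      μH[lam] (Metric.ball x r ∩ E) ≤ ENNReal.ofReal (C * r ^ lam)

/-- A totally bounded set contains a finite maximal `δ`-separated subset. -/
theorem exists_finset_separated_cover {X : Type*} [PseudoMetricSpace X] {A : Set X}
    (hA : TotallyBounded A) {δ : ℝ} (hδ : 0 < δ) :
    ∃ S : Finset X, (∀ y ∈ S, y ∈ A) ∧ (∀ y ∈ S, ∀ z ∈ S, y ≠ z → δ < dist y z) ∧
      ∀ x ∈ A, ∃ y ∈ S, dist x y ≤ δ := by
  lift δ to ℝ≥0 using hδ.le
  have hδ' : δ / 2 ≠ 0 := by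
    have : 0 < δ := by exact_mod_cast hδ
    positivity
  obtain ⟨N, hNA, hNfin, hN⟩ := exists_finite_isCover_of_totallyBounded hδ' hA
  have hpack : packingNumber δ A ≠ ⊤ := by
    have h := packingNumber_two_mul_le_externalCoveringNumber (δ / 2) A
    rw [mul_div_cancel₀ δ two_ne_zero] at h
    exact ((h.trans hN.externalCoveringNumber_le_encard).trans_lt hNfin.encard_lt_top).ne
  have hfin : (maximalSeparatedSet δ A).Finite := by
    rw [← Set.encard_ne_top_iff, encard_maximalSeparatedSet hpack]
    exact hpack
  refine ⟨hfin.toFinset, ?_, ?_, ?_⟩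
  · intro y hy
    exact maximalSeparatedSet_subset (hfin.mem_toFinset.1 hy)
  · intro y hy z hz hyz
    have h : (δ : ℝ≥0∞) < edist y z := isSeparated_maximalSeparatedSet (hfin.mem_toFinset.1 hy)
      (hfin.mem_toFinset.1 hz) hyz
    rw [edist_nndist, ENNReal.coe_lt_coe] at h
    exact_mod_cast h
  · intro x hx
    have h := isCover_iff_subset_iUnion_closedBall.1 (isCover_maximalSeparatedSet hpack) hx
    simp only [mem_iUnion, mem_closedBall] at h
    obtain ⟨y, hy, hxy⟩ := h
    exact ⟨y, hfin.mem_toFinset.2 hy, hxy⟩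

/-- If around every point of `E` and at every scale `r` there are at least `η ^ (-lam)` points of
`E` that are `4 * η * r`-separated, then the balls of every finite cover of `E ∩ B(x,r)` that
meet this set satisfy the `lam`-content lower bound. -/
theorem finite_cover_content_lower_bound {X : Type*} [PseudoMetricSpace X] {E : Set X}
    {η lam : ℝ} (hη0 : 0 < η) (hη : η ≤ 1 / 2) (hlam : 0 ≤ lam)
    (hE : ∀ x ∈ E, ∀ r : ℝ, 0 < r → ∃ T : Finset X, (∀ t ∈ T, t ∈ E ∩ ball x (r / 2)) ∧
      (∀ t ∈ T, ∀ u ∈ T, t ≠ u → 4 * (η * r) < dist t u) ∧ 1 ≤ T.card * η ^ lam)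
    {ι : Type*} (I : Finset ι) (c : ι → X) (ρ : ι → ℝ) (hρ : ∀ i, 0 < ρ i) (k : ℕ) :
    ∀ x ∈ E, ∀ r : ℝ, 0 < r → (E ∩ ball x r ⊆ ⋃ i ∈ I, ball (c i) (ρ i)) →
      (∀ i ∈ I, r * η ^ (k + 1) ≤ ρ i) → ∀ I' ⊆ I,
      (∀ i ∈ I, (ball (c i) (ρ i) ∩ (E ∩ ball x r)).Nonempty → i ∈ I') →
      η ^ lam * r ^ lam ≤ ∑ i ∈ I', ρ i ^ lam := by
  classical
  have large : ∀ r : ℝ, 0 < r → ∀ I' : Finset ι, ∀ i ∈ I', η * r ≤ ρ i →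
      η ^ lam * r ^ lam ≤ ∑ i ∈ I', ρ i ^ lam := by
    intro r hr I' i hi h
    rw [← Real.mul_rpow hη0.le hr.le]
    exact (Real.rpow_le_rpow (by positivity) h hlam).trans
      (Finset.single_le_sum (f := fun i => ρ i ^ lam)
        (fun j _ => Real.rpow_nonneg (hρ j).le lam) hi)
  induction k with
  | zero =>
    intro x hx r hr hcov hlow I' hI' hmeet
    obtain ⟨i, hi, hxi⟩ := mem_iUnion₂.1 (hcov ⟨hx, mem_ball_self hr⟩)
    refine large r hr I' i (hmeet i hi ⟨x, hxi, hx, mem_ball_self hr⟩) ?_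
    have := hlow i hi
    simpa [mul_comm] using this
  | succ k ih =>
    intro x hx r hr hcov hlow I' hI' hmeet
    by_cases hbig : ∃ i ∈ I', η * r ≤ ρ i
    · obtain ⟨i, hi, h⟩ := hbig
      exact large r hr I' i hi h
    push Not at hbig
    obtain ⟨T, hTE, hTsep, hTcard⟩ := hE x hx r hr
    have hηr : 0 < η * r := by positivity
    have hsub : ∀ t ∈ T, ball t (η * r) ⊆ ball x r := by
      intro t ht
      refine ball_subset_ball' ?_
      have h1 := (hTE t ht).2
      rw [mem_ball] at h1
      nlinarith
    set F : X → Finset ι := fun t =>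
      I'.filter fun i => (ball (c i) (ρ i) ∩ (E ∩ ball t (η * r))).Nonempty with hF
    have hone : ∀ t ∈ T, η ^ lam * (η * r) ^ lam ≤ ∑ i ∈ F t, ρ i ^ lam := by
      intro t ht
      refine ih t (hTE t ht).1 (η * r) hηr ?_ ?_ (F t) ?_ ?_
      · exact (inter_subset_inter_right E (hsub t ht)).trans hcov
      · intro i hi
        refine le_trans (le_of_eq ?_) (hlow i hi)
        ring
      · exact (Finset.filter_subset _ _).trans hI'
      · intro i hi hne
        refine Finset.mem_filter.2 ⟨hmeet i hi (hne.mono ?_), hne⟩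
        exact inter_subset_inter_right _ (inter_subset_inter_right E (hsub t ht))
    have hdisj : (T : Set X).PairwiseDisjoint F := by
      intro t ht u hu htu
      refine Finset.disjoint_left.2 fun i hit hiu => ?_
      obtain ⟨hi, y, hyi, -, hyt⟩ := Finset.mem_filter.1 hit
      obtain ⟨-, z, hzi, -, hzu⟩ := Finset.mem_filter.1 hiu
      rw [mem_ball] at hyi hyt hzi hzu
      have h1 := hTsep t ht u hu htu
      have h2 := hbig i hi
      have h3 := dist_triangle4 t y z u
      have h4 := dist_triangle_right y z (c i)
      rw [dist_comm t y] at h3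
      linarith
    calc η ^ lam * r ^ lam
        ≤ (T.card * η ^ lam) * (η ^ lam * r ^ lam) :=
          le_mul_of_one_le_left (by positivity) hTcard
      _ = ∑ t ∈ T, η ^ lam * (η * r) ^ lam := by
          rw [Finset.sum_const, nsmul_eq_mul, Real.mul_rpow hη0.le hr.le]
          ring
      _ ≤ ∑ t ∈ T, ∑ i ∈ F t, ρ i ^ lam := Finset.sum_le_sum hone
      _ = ∑ i ∈ T.biUnion F, ρ i ^ lam := (Finset.sum_biUnion hdisj).symm
      _ ≤ ∑ i ∈ I', ρ i ^ lam := by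
          refine Finset.sum_le_sum_of_subset_of_nonneg ?_
            fun i _ _ => Real.rpow_nonneg (hρ i).le lam
          exact Finset.biUnion_subset.2 fun t _ => Finset.filter_subset _ _

/-- The separation condition at every point and scale gives a lower bound for the Hausdorff
content of a closed set. -/
theorem hContent_lower_bound_of_separated {n : ℕ} {E : Set (Euc n)} (hEclosed : IsClosed E)
    {η lam : ℝ} (hη0 : 0 < η) (hη : η ≤ 1 / 2) (hlam : 0 ≤ lam)
    (hE : ∀ x ∈ E, ∀ r : ℝ, 0 < r → ∃ T : Finset (Euc n), (∀ t ∈ T, t ∈ E ∩ ball x (r / 2)) ∧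
      (∀ t ∈ T, ∀ u ∈ T, t ≠ u → 4 * (η * r) < dist t u) ∧ 1 ≤ T.card * η ^ lam)
    {x : Euc n} (hx : x ∈ E) {r : ℝ} (hr : 0 < r) :
    ENNReal.ofReal ((η / 2) ^ lam * r ^ lam) ≤ hContent n lam (ball x r ∩ E) := by
  refine le_iInf fun c => le_iInf fun hc => le_iInf fun hcov => ?_
  have hK : IsCompact (closedBall x (r / 2) ∩ E) :=
    (isCompact_closedBall x (r / 2)).inter_right hEclosed
  obtain ⟨I, hI⟩ := hK.elim_finite_subcover (fun i => ball (c i).1 (c i).2)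
    (fun i => isOpen_ball) ((inter_subset_inter_left E
      (closedBall_subset_ball (half_lt_self hr))).trans hcov)
  obtain ⟨k, hk⟩ : ∃ k : ℕ, ∀ i ∈ I, r / 2 * η ^ (k + 1) ≤ (c i).2 := by
    have hlim : Filter.Tendsto (fun k : ℕ => r / 2 * η ^ (k + 1)) Filter.atTop (𝓝 0) := by
      have := ((tendsto_pow_atTop_nhds_zero_of_lt_one hη0.le
        (by linarith : η < 1)).comp (Filter.tendsto_add_atTop_nat 1)).const_mul (r / 2)
      simpa using this
    have hev : ∀ᶠ k : ℕ in Filter.atTop, ∀ i ∈ I, r / 2 * η ^ (k + 1) ≤ (c i).2 :=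
      (Filter.eventually_all_finset I).2 fun i _ => hlim.eventually_le_const (hc i)
    exact hev.exists
  have key := finite_cover_content_lower_bound hη0 hη hlam hE I (fun i => (c i).1)
    (fun i => (c i).2) hc k x hx (r / 2) (half_pos hr)
    (fun y hy => hI ⟨ball_subset_closedBall hy.2, hy.1⟩) hk I subset_rfl (fun i hi _ => hi)
  calc ENNReal.ofReal ((η / 2) ^ lam * r ^ lam)
      = ENNReal.ofReal (η ^ lam * (r / 2) ^ lam) := by
        rw [← Real.mul_rpow (by positivity) hr.le, ← Real.mul_rpow hη0.le (by positivity)]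
        congr 2
        ring
    _ ≤ ENNReal.ofReal (∑ i ∈ I, (c i).2 ^ lam) := ENNReal.ofReal_le_ofReal key
    _ = ∑ i ∈ I, ENNReal.ofReal ((c i).2 ^ lam) :=
        ENNReal.ofReal_sum_of_nonneg fun i _ => Real.rpow_nonneg (hc i).le lam
    _ ≤ ∑' i, ENNReal.ofReal ((c i).2 ^ lam) := ENNReal.sum_le_tsum I

/-- The volume of the unit ball of `ℝⁿ`. -/
def unitBallVol (n : ℕ) : ℝ := volume.real (ball (0 : Euc n) 1)

theorem unitBallVol_pos (n : ℕ) : 0 < unitBallVol n :=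
  ENNReal.toReal_pos (measure_ball_pos volume 0 one_pos).ne' measure_ball_lt_top.ne

theorem volume_ball_eq {n : ℕ} (hn : 0 < n) (x : Euc n) {r : ℝ} (hr : 0 ≤ r) :
    volume (ball x r) = ENNReal.ofReal (unitBallVol n * r ^ (n : ℝ)) := by
  have : Nonempty (Fin n) := ⟨⟨0, hn⟩⟩
  rw [Measure.addHaar_ball volume x hr, finrank_euclideanSpace_fin, mul_comm (unitBallVol n),
    ENNReal.ofReal_mul (by positivity), Real.rpow_natCast, unitBallVol, measureReal_def,
    ENNReal.ofReal_toReal measure_ball_lt_top.ne]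

/-- The dyadic annulus `B(x,ρ) \ B(x,ρ/2)` has at least half of the volume of `B(x,ρ)`. -/
theorem volume_annulus_ge {n : ℕ} (hn : 0 < n) (x : Euc n) {ρ : ℝ} (hρ : 0 < ρ) :
    ENNReal.ofReal (unitBallVol n * ρ ^ (n : ℝ) / 2) ≤ volume (ball x ρ \ ball x (ρ / 2)) := by
  have hω := unitBallVol_pos n
  refine le_trans ?_ le_measure_sdiff
  rw [volume_ball_eq hn x hρ.le, volume_ball_eq hn x (half_pos hρ).le,
    ← ENNReal.ofReal_sub _ (by positivity)]
  refine ENNReal.ofReal_le_ofReal ?_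
  have h1 : (ρ / 2) ^ (n : ℝ) ≤ ρ ^ (n : ℝ) / 2 := by
    rw [Real.div_rpow hρ.le two_pos.le]
    refine div_le_div_of_nonneg_left (by positivity) two_pos ?_
    have hn1 : (1 : ℝ) ≤ n := by exact_mod_cast hn
    calc (2 : ℝ) = 2 ^ (1 : ℝ) := (Real.rpow_one 2).symm
      _ ≤ 2 ^ (n : ℝ) := Real.rpow_le_rpow_of_exponent_le one_le_two hn1
  nlinarith

/-- Capacity estimate by the volumes of the neighbourhoods at `J` consecutive dyadic scales. -/
theorem rieszCap_le_of_volume_thickening {n : ℕ} {s p : ℝ} (hn : 0 < n) (hp : 0 < p)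
    (hsn : s < n) {K : Set (Euc n)} {ρ : ℝ} (hρ : 0 < ρ) {J : ℕ} (hJ : 0 < J) {B : ℝ}
    (hB : ∀ j < J, volume (thickening (ρ / 2 ^ j) K) ≤
      ENNReal.ofReal (B * (ρ / 2 ^ j) ^ (s * p))) :
    rieszCap n s p K ≤ ENNReal.ofReal ((2 / (unitBallVol n * J)) ^ p * (J * B)) := by
  have hω := unitBallVol_pos n
  have hJ' : (0 : ℝ) < J := by exact_mod_cast hJ
  set a : ℝ := 2 / (unitBallVol n * J) with ha
  have ha0 : 0 < a := by positivity
  set q : ℕ → ℝ := fun j => ρ / 2 ^ j with hq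
  have hq0 : ∀ j, 0 < q j := fun j => by positivity
  have hqs : ∀ j, q (j + 1) = q j / 2 := fun j => by simp only [hq, pow_succ]; field_simp
  have hqanti : Antitone q := antitone_nat_of_succ_le fun j => by
    rw [hqs]; linarith [hq0 j]
  set g : ℕ → Euc n → ℝ := fun j =>
    (thickening (q j) K).indicator fun _ => (q j) ^ (-(s * p)) with hg
  have hg0 : ∀ j y, 0 ≤ g j y := fun j y =>
    indicator_nonneg (fun _ _ => Real.rpow_nonneg (hq0 j).le _) y
  have hgm : ∀ j, Measurable (g j) := fun j =>
    measurable_const.indicator isOpen_thickening.measurableSet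
  set G : Euc n → ℝ := fun y => ∑ j ∈ Finset.range J, g j y with hG
  have hG0 : ∀ y, 0 ≤ G y := fun y => Finset.sum_nonneg fun j _ => hg0 j y
  have hGm : Measurable G := Finset.measurable_fun_sum _ fun j _ => hgm j
  set f : Euc n → ℝ := fun y => a * G y ^ (1 / p) with hf
  have hfm : Measurable f := (hGm.pow_const _).const_mul a
  have hf0 : ∀ y, 0 ≤ f y := fun y => mul_nonneg ha0.le (Real.rpow_nonneg (hG0 y) _)
  have hfge : ∀ j < J, ∀ y ∈ thickening (q j) K, a * q j ^ (-s) ≤ f y := by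
    intro j hj y hy
    refine mul_le_mul_of_nonneg_left ?_ ha0.le
    calc q j ^ (-s) = (q j ^ (-(s * p))) ^ (1 / p) := by
          rw [← Real.rpow_mul (hq0 j).le]
          congr 1
          field_simp
      _ ≤ G y ^ (1 / p) := by
          refine Real.rpow_le_rpow (Real.rpow_nonneg (hq0 j).le _) ?_ (by positivity)
          have h1 : g j y = q j ^ (-(s * p)) := indicator_of_mem hy _
          rw [← h1]
          exact Finset.single_le_sum (f := fun j => g j y) (fun i _ => hg0 i y)
            (Finset.mem_range.2 hj)
  refine (iInf₂_le_of_le f hfm (iInf₂_le_of_le hf0 ?_ le_rfl)).trans ?_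
  · intro x hx
    set A : ℕ → Set (Euc n) := fun j => ball x (q j) \ ball x (q (j + 1)) with hA
    have hAm : ∀ j, MeasurableSet (A j) := fun j => measurableSet_ball.diff measurableSet_ball
    have hAdisj : Pairwise (Function.onFun Disjoint A) := by
      refine (pairwise_disjoint_on A).2 fun i j hij => ?_
      refine disjoint_left.2 fun y hyi hyj => hyi.2 ?_
      exact ball_subset_ball (hqanti hij) hyj.1
    have hterm : ∀ j ∈ Finset.range J, ENNReal.ofReal (1 / J) ≤
        ∫⁻ y in A j, ENNReal.ofReal (f y) * ENNReal.ofReal (dist x y ^ (s - (n : ℝ))) := by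
      intro j hj
      have hj := Finset.mem_range.1 hj
      calc ENNReal.ofReal (1 / J)
          = ENNReal.ofReal (a * q j ^ (-s) * q j ^ (s - n)) *
              ENNReal.ofReal (unitBallVol n * q j ^ (n : ℝ) / 2) := by
            have h0 := hq0 j
            rw [← ENNReal.ofReal_mul (by positivity)]
            congr 1
            have h1 : q j ^ (-s) * q j ^ (s - n) * q j ^ (n : ℝ) = 1 := by
              rw [← Real.rpow_add h0, ← Real.rpow_add h0,
                show -s + (s - n) + (n : ℝ) = 0 by ring, Real.rpow_zero]
            calc (1 : ℝ) / J = a * unitBallVol n / 2 * 1 := by rw [ha]; field_simp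
              _ = _ := by rw [← h1]; ring
        _ ≤ ENNReal.ofReal (a * q j ^ (-s) * q j ^ (s - n)) * volume (A j) := by
            gcongr
            change _ ≤ volume (ball x (q j) \ ball x (q (j + 1)))
            rw [hqs]
            exact volume_annulus_ge hn x (hq0 j)
        _ = ∫⁻ y in A j, ENNReal.ofReal (a * q j ^ (-s) * q j ^ (s - n)) := by
            rw [setLIntegral_const]
        _ ≤ _ := by
            refine setLIntegral_mono' (hAm j) fun y hy => ?_
            have h0 := hq0 j
            rw [ENNReal.ofReal_mul (by positivity)]
            have hy1 : dist x y < q j := by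
              have := hy.1
              rwa [mem_ball'] at this
            have hy2 : q (j + 1) ≤ dist x y := by
              have := hy.2
              rwa [mem_ball', not_lt] at this
            refine mul_le_mul' (ENNReal.ofReal_le_ofReal (hfge j hj y ?_))
              (ENNReal.ofReal_le_ofReal ?_)
            · exact mem_thickening_iff.2 ⟨x, hx, by rwa [dist_comm]⟩
            · exact Real.rpow_le_rpow_of_nonpos ((hq0 (j + 1)).trans_le hy2) hy1.le
                (by linarith)
    calc (1 : ℝ≥0∞) = ∑ _j ∈ Finset.range J, ENNReal.ofReal (1 / J) := by
          rw [Finset.sum_const, Finset.card_range, ← ENNReal.ofReal_nsmul, nsmul_eq_mul,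
            mul_one_div_cancel hJ'.ne', ENNReal.ofReal_one]
      _ ≤ ∑ j ∈ Finset.range J, ∫⁻ y in A j,
            ENNReal.ofReal (f y) * ENNReal.ofReal (dist x y ^ (s - (n : ℝ))) :=
          Finset.sum_le_sum hterm
      _ = ∫⁻ y in ⋃ j ∈ Finset.range J, A j,
            ENNReal.ofReal (f y) * ENNReal.ofReal (dist x y ^ (s - (n : ℝ))) :=
          (lintegral_biUnion_finset (hAdisj.set_pairwise _) (fun j _ => hAm j) _).symm
      _ ≤ _ := setLIntegral_le_lintegral _ _
  · calc ∫⁻ y, ENNReal.ofReal (f y ^ p)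
        = ∫⁻ y, ENNReal.ofReal (a ^ p) * ∑ j ∈ Finset.range J, ENNReal.ofReal (g j y) := by
          refine lintegral_congr fun y => ?_
          rw [← ENNReal.ofReal_sum_of_nonneg fun j _ => hg0 j y,
            ← ENNReal.ofReal_mul (by positivity)]
          congr 1
          simp only [hf]
          rw [Real.mul_rpow ha0.le (Real.rpow_nonneg (hG0 y) _), ← Real.rpow_mul (hG0 y),
            one_div_mul_cancel hp.ne', Real.rpow_one]
      _ = ENNReal.ofReal (a ^ p) * ∑ j ∈ Finset.range J, ∫⁻ y, ENNReal.ofReal (g j y) := by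
          rw [lintegral_const_mul _ (Finset.measurable_fun_sum _
            fun j _ => (hgm j).ennreal_ofReal),
            lintegral_finsetSum _ fun j _ => (hgm j).ennreal_ofReal]
      _ ≤ ENNReal.ofReal (a ^ p) * ∑ j ∈ Finset.range J, ENNReal.ofReal B := by
          gcongr with j hj
          have h0 := hq0 j
          have h1 : ∀ y, ENNReal.ofReal (g j y) = (thickening (q j) K).indicator
              (fun _ => ENNReal.ofReal (q j ^ (-(s * p)))) y := fun y => by
            simp only [hg, indicator]
            split_ifs <;> simp
          simp_rw [h1]
          rw [lintegral_indicator_const isOpen_thickening.measurableSet]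
          refine (mul_le_mul_right (hB j (Finset.mem_range.1 hj)) _).trans (le_of_eq ?_)
          rw [← ENNReal.ofReal_mul (by positivity)]
          congr 1
          change q j ^ (-(s * p)) * (B * q j ^ (s * p)) = B
          rw [mul_left_comm, ← Real.rpow_add h0]
          simp
      _ = ENNReal.ofReal (a ^ p * (J * B)) := by
          rw [Finset.sum_const, Finset.card_range, ← ENNReal.ofReal_nsmul, nsmul_eq_mul,
            ← ENNReal.ofReal_mul (by positivity)]

theorem volume_thickening_ne_top {n : ℕ} {A : Set (Euc n)} (hA : Bornology.IsBounded A) (h : ℝ) :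
    volume (thickening h A) ≠ ⊤ :=
  hA.thickening.measure_lt_top.ne

/-- The volume of the `h`-neighbourhood of a bounded set controls its capacity from above. -/
theorem volume_thickening_ge_of_le_rieszCap {n : ℕ} {s p : ℝ} (hn : 0 < n) (hp : 0 < p)
    (hsn : s < n) {A : Set (Euc n)} (hA : Bornology.IsBounded A) {h : ℝ} (hh : 0 < h) {b : ℝ}
    (hb : ENNReal.ofReal b ≤ rieszCap n s p A) :
    b * h ^ (s * p) * (unitBallVol n / 2) ^ p ≤ volume.real (thickening h A) := by
  have hω := unitBallVol_pos n
  set V := volume.real (thickening h A) with hV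
  have hV0 : 0 ≤ V := measureReal_nonneg
  have hhs : 0 < h ^ (s * p) := by positivity
  have key := hb.trans (rieszCap_le_of_volume_thickening (J := 1) (B := V / h ^ (s * p))
    hn hp hsn hh one_pos (by
      intro j hj
      obtain rfl : j = 0 := by omega
      rw [pow_zero, div_one, div_mul_cancel₀ _ hhs.ne', hV,
        ofReal_measureReal (volume_thickening_ne_top hA h)]))
  rw [Nat.cast_one, mul_one, one_mul, ENNReal.ofReal_le_ofReal_iff (by positivity),
    ← inv_div, Real.inv_rpow (by positivity)] at key
  have hωp : 0 < (unitBallVol n / 2) ^ p := by positivity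
  calc b * h ^ (s * p) * (unitBallVol n / 2) ^ p
      ≤ (((unitBallVol n / 2) ^ p)⁻¹ * (V / h ^ (s * p))) * h ^ (s * p) *
          (unitBallVol n / 2) ^ p := by gcongr
    _ = V := by field_simp

/-- The volume of a neighbourhood of a set covered by finitely many balls. -/
theorem volume_thickening_le_card {n : ℕ} (hn : 0 < n) {A : Set (Euc n)} {S : Finset (Euc n)}
    {δ h : ℝ} (hδ : 0 ≤ δ) (hh : 0 ≤ h) (hS : ∀ x ∈ A, ∃ y ∈ S, dist x y ≤ δ) :
    volume (thickening h A) ≤ ENNReal.ofReal (S.card * (unitBallVol n * (δ + h) ^ (n : ℝ))) := by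
  have hω := unitBallVol_pos n
  have hsub : thickening h A ⊆ ⋃ y ∈ S, ball y (δ + h) := by
    intro z hz
    obtain ⟨x, hx, hzx⟩ := mem_thickening_iff.1 hz
    obtain ⟨y, hy, hxy⟩ := hS x hx
    refine mem_iUnion₂.2 ⟨y, hy, ?_⟩
    rw [mem_ball]
    linarith [dist_triangle z x y]
  refine (measure_mono hsub).trans ((measure_biUnion_finset_le S _).trans (le_of_eq ?_))
  rw [Finset.sum_congr rfl fun y _ => volume_ball_eq hn y (add_nonneg hδ hh), Finset.sum_const,
    ← ENNReal.ofReal_nsmul, nsmul_eq_mul]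

/-- In a uniformly fat set, a maximal `4h`-separated set in a ball of radius `r / 2`, where
`h = r / 2 ^ (J + 3)`, has at least `c * J ^ (p - 1) * (r / h) ^ (n - s * p)` points. -/
theorem UniformlyFat.exists_separated {n : ℕ} {s p : ℝ} (hn : 0 < n) (hp : 0 < p)
    (hsn : s < n) {E : Set (Euc n)} (hfat : UniformlyFat n s p E) :
    ∃ c : ℝ, 0 < c ∧ ∀ J : ℕ, 0 < J → ∀ x ∈ E, ∀ r : ℝ, 0 < r →
      ∃ T : Finset (Euc n), (∀ t ∈ T, t ∈ E ∩ ball x (r / 2)) ∧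
        (∀ t ∈ T, ∀ u ∈ T, t ≠ u → 4 * (r / 2 ^ (J + 3)) < dist t u) ∧
        c * (J : ℝ) ^ (p - 1) * r ^ (n - s * p) ≤ T.card * (r / 2 ^ (J + 3)) ^ (n - s * p) := by
  obtain ⟨σ, hσ, hfat⟩ := hfat
  have hω := unitBallVol_pos n
  set ω := unitBallVol n with hω_def
  set d : ℝ := n - s * p with hd
  set M : ℝ := ω ^ 2 * 2 ^ (n : ℝ) * 5 ^ (n : ℝ) * 4 ^ d / (σ * (ω / 2) ^ p) with hM
  have hM0 : 0 < M := by positivity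
  refine ⟨σ * (4 ^ d)⁻¹ * (ω / 2) ^ p / M, by positivity, fun J hJ x hx r hr => ?_⟩
  have hJ' : (0 : ℝ) < J := by exact_mod_cast hJ
  set h : ℝ := r / 2 ^ (J + 3) with hh
  have hh0 : 0 < h := by positivity
  have htb : ∀ δ : ℝ, TotallyBounded (E ∩ ball x δ) := fun δ =>
    (isCompact_closedBall x δ).totallyBounded.subset
      (inter_subset_right.trans ball_subset_closedBall)
  obtain ⟨T, hTA, hTsep, hTcov⟩ := exists_finset_separated_cover (htb (r / 2))
    (δ := 4 * h) (by positivity)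
  refine ⟨T, hTA, hTsep, ?_⟩
  set A := E ∩ ball x (r / 2) with hA
  have hAb : Bornology.IsBounded A := isBounded_ball.subset inter_subset_right
  have hVA : volume.real (thickening h A) ≤ T.card * (ω * (5 * h) ^ (n : ℝ)) := by
    refine ENNReal.toReal_le_of_le_ofReal (by positivity) ?_
    refine (volume_thickening_le_card hn (by positivity) hh0.le hTcov).trans (le_of_eq ?_)
    rw [← hω_def, show 4 * h + h = 5 * h by ring]
  have hvol : ∀ j < J, volume (thickening (r / 4 / 2 ^ j) (ball x (r / 4) ∩ E)) ≤
      ENNReal.ofReal ((M * (T.card * h ^ d)) * (r / 4 / 2 ^ j) ^ (s * p)) := by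
    intro j hj
    set ρ : ℝ := r / 4 / 2 ^ j with hρ
    have hρ0 : 0 < ρ := by positivity
    have hρr : ρ ≤ r / 4 := div_le_self (by positivity) (one_le_pow₀ one_le_two)
    have hhρ : h ≤ ρ / 4 := by
      have h1 : (2 : ℝ) ^ (j + 1) ≤ 2 ^ J := pow_le_pow_right₀ one_le_two hj
      rw [hρ, hh, div_div, div_div]
      refine div_le_div_of_nonneg_left hr.le (by positivity) ?_
      rw [pow_add, pow_succ] at *
      linarith
    obtain ⟨S, hSK, hSsep, hScov⟩ := exists_finset_separated_cover (htb (r / 4)) hρ0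
    have hSvol := volume_thickening_le_card hn hρ0.le hρ0.le hScov
    rw [inter_comm] at hSvol
    refine hSvol.trans (ENNReal.ofReal_le_ofReal ?_)
    have hpiece : ∀ y ∈ S, σ * (ρ / 4) ^ d * h ^ (s * p) * (ω / 2) ^ p ≤
        volume.real (thickening h (ball y (ρ / 4) ∩ E)) := fun y hy =>
      volume_thickening_ge_of_le_rieszCap hn hp hsn
        (isBounded_ball.subset inter_subset_left) hh0
        (hfat y (hSK y hy).1 (ρ / 4) (by positivity))
    have hdisj : (S : Set (Euc n)).PairwiseDisjoint
        fun y => thickening h (ball y (ρ / 4) ∩ E) := by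
      intro y hy z hz hyz
      refine disjoint_left.2 fun w hwy hwz => ?_
      obtain ⟨u, ⟨hu, -⟩, hwu⟩ := mem_thickening_iff.1 hwy
      obtain ⟨v, ⟨hv, -⟩, hwv⟩ := mem_thickening_iff.1 hwz
      rw [mem_ball] at hu hv
      have h1 := hSsep y hy z hz hyz
      have h2 := dist_triangle_left y z w
      have h3 := dist_triangle w u y
      have h4 := dist_triangle w v z
      linarith
    have hunion : (⋃ y ∈ S, thickening h (ball y (ρ / 4) ∩ E)) ⊆ thickening h A := by
      refine iUnion₂_subset fun y hy => thickening_subset_of_subset h ?_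
      rintro z ⟨hzy, hzE⟩
      refine ⟨hzE, ?_⟩
      have h1 := (hSK y hy).2
      rw [mem_ball] at hzy h1 ⊢
      linarith [dist_triangle z y x]
    have hcount : S.card * (σ * (ρ / 4) ^ d * h ^ (s * p) * (ω / 2) ^ p) ≤
        T.card * (ω * (5 * h) ^ (n : ℝ)) := by
      calc S.card * (σ * (ρ / 4) ^ d * h ^ (s * p) * (ω / 2) ^ p)
          = ∑ y ∈ S, σ * (ρ / 4) ^ d * h ^ (s * p) * (ω / 2) ^ p := by
            rw [Finset.sum_const, nsmul_eq_mul]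
        _ ≤ ∑ y ∈ S, volume.real (thickening h (ball y (ρ / 4) ∩ E)) :=
            Finset.sum_le_sum hpiece
        _ = volume.real (⋃ y ∈ S, thickening h (ball y (ρ / 4) ∩ E)) :=
            (measureReal_biUnion_finset hdisj
              (fun y _ => isOpen_thickening.measurableSet)
              (fun y _ => volume_thickening_ne_top
                (isBounded_ball.subset inter_subset_left) h)).symm
        _ ≤ volume.real (thickening h A) :=
            measureReal_mono hunion (volume_thickening_ne_top hAb h)
        _ ≤ _ := hVA
    have hpow : ∀ z : ℝ, 0 < z → z ^ (n : ℝ) = z ^ d * z ^ (s * p) := fun z hz => by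
      rw [← Real.rpow_add hz]
      congr 1
      ring
    have hD : 0 < σ * (ρ / 4) ^ d * h ^ (s * p) * (ω / 2) ^ p := by positivity
    calc S.card * (ω * (ρ + ρ) ^ (n : ℝ))
        ≤ T.card * (ω * (5 * h) ^ (n : ℝ)) /
            (σ * (ρ / 4) ^ d * h ^ (s * p) * (ω / 2) ^ p) * (ω * (ρ + ρ) ^ (n : ℝ)) := by
          gcongr
          rwa [le_div_iff₀ hD]
      _ = M * (T.card * h ^ d) * ρ ^ (s * p) := by
          rw [← two_mul, Real.mul_rpow two_pos.le hρ0.le, Real.mul_rpow (by norm_num) hh0.le,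
            Real.div_rpow hρ0.le (by norm_num), hpow h hh0, hpow ρ hρ0, hM]
          have e1 : 0 < ρ ^ d := by positivity
          have e2 : 0 < h ^ (s * p) := by positivity
          have e3 : 0 < (4 : ℝ) ^ d := by positivity
          have e4 : 0 < (ω / 2) ^ p := by positivity
          generalize (ω / 2) ^ p = w at *
          field_simp
  have key := (hfat x hx (r / 4) (by positivity)).trans
    (rieszCap_le_of_volume_thickening hn hp hsn (by positivity) hJ hvol)
  rw [ENNReal.ofReal_le_ofReal_iff (by positivity)] at key
  have e1 : (2 / (ω * J)) ^ p = ((ω / 2) ^ p)⁻¹ * ((J : ℝ) ^ p)⁻¹ := by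
    rw [← Real.inv_rpow (by positivity), ← Real.inv_rpow hJ'.le,
      ← Real.mul_rpow (by positivity) (by positivity)]
    congr 1
    field_simp
  have e2 : (J : ℝ) ^ (p - 1) = J ^ p / J := by rw [Real.rpow_sub hJ', Real.rpow_one]
  rw [← hω_def, e1, Real.div_rpow hr.le (by norm_num)] at key
  rw [e2]
  have f1 : 0 < (ω / 2) ^ p := by positivity
  have f2 : 0 < (J : ℝ) ^ p := by positivity
  have f3 : 0 < (4 : ℝ) ^ d := by positivity
  generalize (ω / 2) ^ p = w at *
  generalize (J : ℝ) ^ p = v at *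
  calc σ * (4 ^ d)⁻¹ * w / M * (v / J) * r ^ d
      = σ * (r ^ d / 4 ^ d) * (w * v / (M * J)) := by field_simp
    _ ≤ w⁻¹ * v⁻¹ * (J * (M * (T.card * h ^ d))) * (w * v / (M * J)) := by gcongr
    _ = T.card * h ^ d := by field_simp

/-- If `1<p<∞`, `0<sp<n`, and `E ⊆ ℝⁿ` is closed and `(s,p)`-uniformly fat,
then there are `n-sp < λ ≤ n` and `C>0` with `H^λ_∞(B(x,r) ∩ E) ≥ C r^λ` for every
`x ∈ E` and `r > 0`. -/
theorem statement5 (n : ℕ) (s p : ℝ) (hp1 : 1 < p) (hsp0 : 0 < s * p) (hspn : s * p < n)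
    (E : Set (Euc n)) (hEclosed : IsClosed E) (hfat : UniformlyFat n s p E) :
    ∃ lam C : ℝ, (n : ℝ) - s * p < lam ∧ lam ≤ n ∧ 0 < C ∧
      ∀ x ∈ E, ∀ r : ℝ, 0 < r →
        ENNReal.ofReal (C * r ^ lam) ≤ hContent n lam (Metric.ball x r ∩ E) := by
  have hn : 0 < n := by
    have : (0 : ℝ) < n := hsp0.trans hspn
    exact_mod_cast this
  have hp : 0 < p := one_pos.trans hp1
  have hs : 0 < s := pos_of_mul_pos_left hsp0 hp.le
  have hsn : s < n := by nlinarith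
  obtain ⟨c, hc, hsep⟩ := hfat.exists_separated hn hp hsn
  set d : ℝ := n - s * p with hd
  obtain ⟨J, hJ0, hJ⟩ : ∃ J : ℕ, 0 < J ∧ 2 ≤ c * (J : ℝ) ^ (p - 1) := by
    have hlim : Filter.Tendsto (fun J : ℕ => c * (J : ℝ) ^ (p - 1)) Filter.atTop Filter.atTop :=
      ((tendsto_rpow_atTop (sub_pos.2 hp1)).comp tendsto_natCast_atTop_atTop).const_mul_atTop hc
    obtain ⟨J, h1, h2⟩ := ((Filter.eventually_gt_atTop 0).and
      (hlim.eventually_ge_atTop 2)).exists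
    exact ⟨J, h1, h2⟩
  set η : ℝ := 1 / 2 ^ (J + 3) with hη
  have hη0 : 0 < η := by positivity
  have hη2 : η ≤ 1 / 2 := by
    refine div_le_div_of_nonneg_left zero_le_one two_pos ?_
    exact le_self_pow₀ one_le_two (by omega)
  set lam : ℝ := min (d + 1 / (J + 3)) n with hlam
  have hdlam : d < lam := lt_min (lt_add_of_pos_right d (by positivity)) (by linarith)
  have hηlam : η ^ d ≤ 2 * η ^ lam := by
    have h1 : η ^ (d + 1 / ((J : ℝ) + 3)) ≤ η ^ lam :=
      Real.rpow_le_rpow_of_exponent_ge hη0 (by linarith) (min_le_left _ _)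
    have h2 : η ^ (1 / ((J : ℝ) + 3)) = 1 / 2 := by
      have : η = (1 / 2) ^ ((J : ℝ) + 3) := by
        rw [hη, ← one_div_pow, ← Real.rpow_natCast]
        push_cast
        rfl
      rw [this, ← Real.rpow_mul (by positivity), mul_one_div_cancel (by positivity),
        Real.rpow_one]
    rw [Real.rpow_add hη0, h2] at h1
    linarith
  refine ⟨lam, (η / 2) ^ lam, hdlam, min_le_right _ _, by positivity, fun x hx r hr => ?_⟩
  refine hContent_lower_bound_of_separated hEclosed hη0 hη2 (by linarith) ?_ hx hr
  intro y hy ρ hρ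
  obtain ⟨T, hT, hTsep, hTcard⟩ := hsep J hJ0 y hy ρ hρ
  have hηρ : η * ρ = ρ / 2 ^ (J + 3) := by rw [hη]; ring
  refine ⟨T, hT, by rwa [hηρ], ?_⟩
  rw [← hηρ, Real.mul_rpow hη0.le hρ.le, ← mul_assoc] at hTcard
  have h1 := le_of_mul_le_mul_right hTcard (by positivity : 0 < ρ ^ d)
  have h2 : (T.card : ℝ) * η ^ d ≤ T.card * (2 * η ^ lam) := by gcongr
  linarith

end
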